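/- arXiv:1309.7440 — 2 statements merged into one kernel-verified Lean document; each statement's English description precedes it below -/
import Mathlib

section
/- (Wedge-weight upper bound) Let G be a finite simple graph, γ ∈ (0,1], and let g be the number of good edges of G. Then the total wedge weight satisfies r(W) ≤ 2·g, where W is the set of all wedges of G. -/
open scoped Classical
open Finset

/-- Jaccard similarity `J_e = |N(i) ∩ N(j)| / |N(i) ∪ N(j) \ {i,j}|` of an edge `{i,j}`. -/
noncomputable def jac {V : Type*} [Fintype V] [DecidableEq V] (G : SimpleGraph V)
    (i j : V) : ℝ :=
  ((G.neighborFinset i ∩ G.neighborFinset j).card : ℝ) /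
    (((G.neighborFinset i ∪ G.neighborFinset j) \ {i, j}).card : ℝ)

/-- `i` and `j` are joined by a good edge: adjacent with Jaccard similarity at least `γ`. -/
def goodAdj {V : Type*} [Fintype V] [DecidableEq V] (G : SimpleGraph V) (γ : ℝ)
    (i j : V) : Prop :=
  G.Adj i j ∧ γ ≤ jac G i j

/-- Weight of a wedge with central vertex `c` and endpoint pair `p`: `1/(d_c − 1)` if it
contains at least one good edge, else `0`. -/
noncomputable def wedgeWeight {V : Type*} [Fintype V] [DecidableEq V] (G : SimpleGraph V)
    (γ : ℝ) (c : V) (p : Finset V) : ℝ :=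
  if ∃ j ∈ p, goodAdj G γ c j then 1 / ((G.degree c : ℝ) - 1) else 0

theorem jac_comm_aux {V : Type*} [Fintype V] [DecidableEq V] (G : SimpleGraph V)
    (i j : V) : jac G i j = jac G j i := by
  unfold jac
  rw [Finset.inter_comm, Finset.union_comm, Finset.pair_comm]

/-- The graph of good edges. -/
def goodGraphAux {V : Type*} [Fintype V] [DecidableEq V] (G : SimpleGraph V) (γ : ℝ) :
    SimpleGraph V where
  Adj := goodAdj G γ
  symm := ⟨fun i j h => ⟨h.1.symm, by rw [jac_comm_aux]; exact h.2⟩⟩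
  loopless := ⟨fun i h => G.loopless.irrefl i h.1⟩

theorem pair_count_aux {V : Type*} [DecidableEq V] (N : Finset V) (j : V) (hj : j ∈ N) :
    ((N.powersetCard 2).filter (fun p => j ∈ p)).card ≤ N.card - 1 := by
  rw [← Finset.card_erase_of_mem hj]
  refine le_trans (Finset.card_le_card ?_) (Finset.card_image_le (f := fun k => ({j, k} : Finset V)))
  intro p hp
  rw [Finset.mem_filter, Finset.mem_powersetCard] at hp
  obtain ⟨⟨hs, hc⟩, hjp⟩ := hp
  obtain ⟨a, b, hab, rfl⟩ := Finset.card_eq_two.1 hc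
  rw [Finset.mem_image]
  have ha : a ∈ N := hs (by simp)
  have hb : b ∈ N := hs (by simp)
  rcases (by simpa using hjp : j = a ∨ j = b) with rfl | rfl
  · exact ⟨b, by simp [hb, hab.symm], rfl⟩
  · exact ⟨a, by simp [ha, hab], Finset.pair_comm _ _⟩

theorem vertex_bound_aux {V : Type*} [Fintype V] [DecidableEq V] (G : SimpleGraph V) (γ : ℝ)
    (i : V) : ∑ p ∈ (G.neighborFinset i).powersetCard 2, wedgeWeight G γ i p ≤
      ((goodGraphAux G γ).degree i : ℝ) := by
  by_cases hd : G.degree i < 2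
  · rw [Finset.powersetCard_eq_empty.2 (by simpa using hd)]
    simp
  have hd2 : (2 : ℝ) ≤ G.degree i := by exact_mod_cast not_lt.1 hd
  have hpos : (0 : ℝ) < (G.degree i : ℝ) - 1 := by linarith
  set S := (goodGraphAux G γ).neighborFinset i with hS
  have hmem : ∀ j, j ∈ S ↔ goodAdj G γ i j := fun j => by
    rw [hS, SimpleGraph.mem_neighborFinset]; rfl
  have h1 : ∀ p ∈ (G.neighborFinset i).powersetCard 2, wedgeWeight G γ i p ≤
      ∑ j ∈ S, if j ∈ p then 1 / ((G.degree i : ℝ) - 1) else 0 := by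
    intro p _
    have hnn : ∀ j ∈ S, (0 : ℝ) ≤ if j ∈ p then 1 / ((G.degree i : ℝ) - 1) else 0 := by
      intro j _
      split_ifs <;> positivity
    unfold wedgeWeight
    split_ifs with h
    · obtain ⟨j, hj, hg⟩ := h
      have := Finset.single_le_sum hnn ((hmem j).2 hg)
      simpa only [hj, if_true] using this
    · exact Finset.sum_nonneg hnn
  refine (Finset.sum_le_sum h1).trans ?_
  rw [Finset.sum_comm, ← SimpleGraph.card_neighborFinset_eq_degree (goodGraphAux G γ), ← hS,
    Finset.card_eq_sum_ones, Nat.cast_sum]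
  refine Finset.sum_le_sum fun j hj => ?_
  have hjN : j ∈ G.neighborFinset i := by
    rw [SimpleGraph.mem_neighborFinset]; exact ((hmem j).1 hj).1
  rw [← Finset.sum_filter, Finset.sum_const, nsmul_eq_mul, mul_one_div, Nat.cast_one,
    div_le_one hpos]
  have h2 := pair_count_aux (G.neighborFinset i) j hjN
  rw [SimpleGraph.card_neighborFinset_eq_degree] at h2
  have h3 : ((((G.neighborFinset i).powersetCard 2).filter (fun p => j ∈ p)).card : ℝ) + 1
      ≤ G.degree i := by
    exact_mod_cast (by omega)
  linarith

/-- Wedge-weight upper bound: the total wedge weight `r(W)` is at most twice the number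
of good edges. -/
theorem wedge_weight_upper_bound {V : Type*} [Fintype V] [DecidableEq V]
    (G : SimpleGraph V) (γ : ℝ) (hγ0 : 0 < γ) (hγ1 : γ ≤ 1) :
    ∑ i, ∑ p ∈ (G.neighborFinset i).powersetCard 2, wedgeWeight G γ i p ≤
      2 * ((G.edgeFinset.filter (fun e => ∀ i j, e = s(i, j) → γ ≤ jac G i j)).card : ℝ) := by
  have hE : G.edgeFinset.filter (fun e => ∀ i j, e = s(i, j) → γ ≤ jac G i j) =
      (goodGraphAux G γ).edgeFinset := by
    ext e
    induction e using Sym2.ind with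
    | _ a b =>
      rw [Finset.mem_filter, SimpleGraph.mem_edgeFinset, SimpleGraph.mem_edgeFinset,
        SimpleGraph.mem_edgeSet, SimpleGraph.mem_edgeSet]
      constructor
      · rintro ⟨h, h'⟩
        exact ⟨h, h' a b rfl⟩
      · rintro ⟨h, h'⟩
        refine ⟨h, fun i j hij => ?_⟩
        rcases Sym2.eq_iff.1 hij with ⟨rfl, rfl⟩ | ⟨rfl, rfl⟩
        · exact h'
        · rw [jac_comm_aux]; exact h'
  rw [hE]
  refine (Finset.sum_le_sum fun i _ => vertex_bound_aux G γ i).trans ?_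
  have := (goodGraphAux G γ).sum_degrees_eq_twice_card_edges
  exact_mod_cast this.le
end

section
/- (Surviving edges after cleaning) Let G be a finite simple graph, γ ∈ (0,1], μ ≥ 1 − γ²/32, and 0 < ε ≤ γ³/12. Assume at least a μ fraction of the edges of G have Jaccard similarity at least γ in G. Let G = G_0, G_1, …, G_m be a sequence of spanning subgraphs where each G_l is obtained from G_{l−1} by deleting one edge whose Jaccard similarity in G_{l−1} is at most ε. Then the number of edges of the final graph G_m that lie in at least one triangle of G_m is at least γ·|E(G)|/4. -/
open scoped Classical
open Finset

/-- Number of edges of a finite simple graph. -/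
noncomputable def ecount {V : Type*} [Fintype V] [DecidableEq V] (G : SimpleGraph V) : ℕ :=
  G.edgeFinset.card

/-- Size of the union in the denominator of the Jaccard similarity. -/
noncomputable def uu {V : Type*} [Fintype V] [DecidableEq V] (G : SimpleGraph V) (i j : V) : ℝ :=
  (((G.neighborFinset i ∪ G.neighborFinset j) \ {i, j}).card : ℝ)

/-- Number of common neighbours. -/
noncomputable def cc {V : Type*} [Fintype V] [DecidableEq V] (G : SimpleGraph V) (i j : V) : ℝ :=
  ((G.neighborFinset i ∩ G.neighborFinset j).card : ℝ)

/-- Weight of a good edge. -/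
noncomputable def ww {V : Type*} [Fintype V] [DecidableEq V] (G : SimpleGraph V) (γ : ℝ)
    (i j : V) : ℝ :=
  if G.Adj i j ∧ γ ≤ jac G i j then 1 / uu G i j else 0

/-- Charge of a deleted edge. -/
noncomputable def bb {V : Type*} [Fintype V] [DecidableEq V] (G : SimpleGraph V) (γ ε : ℝ)
    (i j : V) : ℝ :=
  if G.Adj i j ∧ γ ≤ jac G i j then 3 * ε / γ else 2

/-- Weighted count of ordered triangles. -/
noncomputable def Phi {V : Type*} [Fintype V] [DecidableEq V] (G : SimpleGraph V) (γ : ℝ)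
    (H : SimpleGraph V) : ℝ :=
  ∑ x, ∑ y, ∑ z, if H.Adj x y ∧ H.Adj x z ∧ H.Adj y z then ww G γ x y else 0

/-- Total charge of the edges of `H`. -/
noncomputable def Chg {V : Type*} [Fintype V] [DecidableEq V] (G : SimpleGraph V) (γ ε : ℝ)
    (H : SimpleGraph V) : ℝ :=
  ∑ x, ∑ y, if H.Adj x y then bb G γ ε x y else 0

section helpers
variable {V : Type*} [Fintype V] [DecidableEq V]

lemma uu_comm (G : SimpleGraph V) (i j : V) : uu G i j = uu G j i := by
  unfold uu; rw [Finset.union_comm, Finset.pair_comm]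

lemma jac_comm (G : SimpleGraph V) (i j : V) : jac G i j = jac G j i := by
  unfold jac; rw [Finset.union_comm, Finset.pair_comm, Finset.inter_comm]

lemma jac_eq (G : SimpleGraph V) (i j : V) : jac G i j = cc G i j / uu G i j := rfl

lemma ww_comm (G : SimpleGraph V) (γ : ℝ) (i j : V) : ww G γ i j = ww G γ j i := by
  unfold ww; rw [uu_comm, jac_comm, G.adj_comm]

lemma bb_comm (G : SimpleGraph V) (γ ε : ℝ) (i j : V) : bb G γ ε i j = bb G γ ε j i := by
  unfold bb; rw [jac_comm, G.adj_comm]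

lemma uu_nonneg (G : SimpleGraph V) (i j : V) : 0 ≤ uu G i j := by unfold uu; positivity
lemma cc_nonneg (G : SimpleGraph V) (i j : V) : 0 ≤ cc G i j := by unfold cc; positivity

lemma ww_nonneg (G : SimpleGraph V) (γ : ℝ) (i j : V) : 0 ≤ ww G γ i j := by
  unfold ww; have := uu_nonneg G i j; split_ifs <;> positivity

lemma ww_le (G : SimpleGraph V) (γ : ℝ) (i j : V) : ww G γ i j ≤ 1 / uu G i j := by
  unfold ww; have := uu_nonneg G i j; split_ifs
  · exact le_rfl
  · positivity

lemma cc_le_uu (G : SimpleGraph V) (i j : V) : cc G i j ≤ uu G i j := by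
  unfold cc uu
  norm_cast
  apply Finset.card_le_card
  intro x hx
  simp only [Finset.mem_inter, SimpleGraph.mem_neighborFinset] at hx
  simp only [Finset.mem_sdiff, Finset.mem_union, SimpleGraph.mem_neighborFinset,
    Finset.mem_insert, Finset.mem_singleton, not_or]
  exact ⟨Or.inl hx.1, hx.1.ne', hx.2.ne'⟩

lemma uu_mono {G H : SimpleGraph V} (h : H ≤ G) (i j : V) : uu H i j ≤ uu G i j := by
  unfold uu
  norm_cast
  apply Finset.card_le_card
  intro x hx
  simp only [Finset.mem_sdiff, Finset.mem_union, SimpleGraph.mem_neighborFinset] at hx ⊢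
  exact ⟨hx.1.imp (fun q => h q) (fun q => h q), hx.2⟩

lemma cc_mono {G H : SimpleGraph V} (h : H ≤ G) (i j : V) : cc H i j ≤ cc G i j := by
  unfold cc
  norm_cast
  apply Finset.card_le_card
  intro x hx
  simp only [Finset.mem_inter, SimpleGraph.mem_neighborFinset] at hx ⊢
  exact ⟨h hx.1, h hx.2⟩

lemma cc_comm (G : SimpleGraph V) (i j : V) : cc G i j = cc G j i := by
  unfold cc; rw [Finset.inter_comm]

/-- Common neighbours of `i,j` number at most `d_i - 1`, which is at most `uu i k`. -/
lemma cc_le_uu' (G : SimpleGraph V) {i j k : V} (hij : G.Adj i j) (hik : G.Adj i k) :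
    cc G i j ≤ uu G i k := by
  unfold cc uu
  norm_cast
  calc _ ≤ ((G.neighborFinset i).erase j).card := by
        apply Finset.card_le_card
        intro x hx
        simp only [Finset.mem_inter, SimpleGraph.mem_neighborFinset] at hx
        simp only [Finset.mem_erase, SimpleGraph.mem_neighborFinset]
        exact ⟨hx.2.ne', hx.1⟩
    _ = ((G.neighborFinset i).erase k).card := by
        rw [Finset.card_erase_of_mem (by simpa using hij),
          Finset.card_erase_of_mem (by simpa using hik)]
    _ ≤ _ := by
        apply Finset.card_le_card
        intro x hx
        simp only [Finset.mem_erase, SimpleGraph.mem_neighborFinset] at hx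
        simp only [Finset.mem_sdiff, Finset.mem_union, SimpleGraph.mem_neighborFinset,
          Finset.mem_insert, Finset.mem_singleton, not_or]
        exact ⟨Or.inl hx.2, hx.2.ne', hx.1⟩

/-- The charge for one adjacent edge, bad case. -/
lemma side_bad {G H : SimpleGraph V} (h : H ≤ G) (γ : ℝ) {i j k : V} (hij : G.Adj i j)
    (hik : G.Adj i k) : cc H i j * ww G γ i k ≤ 1 := by
  have h1 := cc_mono h i j
  have h2 := cc_le_uu' G hij hik
  have h3 := cc_nonneg H i j
  calc cc H i j * ww G γ i k ≤ uu G i k * (1 / uu G i k) :=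
        mul_le_mul (h1.trans h2) (ww_le ..) (ww_nonneg ..) (uu_nonneg ..)
    _ ≤ 1 := by rw [mul_one_div]; exact div_self_le_one _

lemma cc_small {G H : SimpleGraph V} (h : H ≤ G) {ε : ℝ} (hε : 0 < ε) {i j : V}
    (hj : jac H i j ≤ ε) : cc H i j ≤ ε * uu G i j := by
  rw [jac_eq] at hj
  have h1 := cc_le_uu H i j
  have h2 := uu_mono h i j
  rcases (uu_nonneg H i j).eq_or_lt with h0 | h0
  · have : 0 ≤ ε * uu G i j := mul_nonneg hε.le (uu_nonneg ..)
    linarith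
  · rw [div_le_iff₀ h0] at hj
    nlinarith

lemma uu_le_of_good {G : SimpleGraph V} {γ : ℝ} {i j : V}
    (hj : γ ≤ jac G i j) : γ * uu G i j ≤ cc G i j := by
  rw [jac_eq] at hj
  rcases (uu_nonneg G i j).eq_or_lt with h0 | h0
  · rw [← h0, mul_zero]; exact cc_nonneg ..
  · rwa [le_div_iff₀ h0] at hj

lemma side_good {G H : SimpleGraph V} (h : H ≤ G) {γ ε : ℝ} (hγ : 0 < γ) (hε : 0 < ε) {i j k : V}
    (hij : G.Adj i j) (hik : G.Adj i k) (hj : jac H i j ≤ ε) (hg : γ ≤ jac G i j) :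
    cc H i j * ww G γ i k ≤ ε / γ := by
  have h1 := cc_small h hε hj
  have h2 := uu_le_of_good hg
  have h3 := cc_le_uu' G hij hik
  have h4 : cc H i j ≤ ε / γ * uu G i k := by
    rw [div_mul_eq_mul_div, le_div_iff₀ hγ]
    nlinarith
  calc cc H i j * ww G γ i k ≤ (ε / γ * uu G i k) * (1 / uu G i k) :=
        mul_le_mul h4 (ww_le ..) (ww_nonneg ..) ((cc_nonneg ..).trans h4)
    _ = ε / γ * (uu G i k / uu G i k) := by ring
    _ ≤ ε / γ * 1 := by gcongr; exact div_self_le_one _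
    _ = _ := mul_one _

lemma mid_good {G H : SimpleGraph V} (h : H ≤ G) {γ ε : ℝ} (hγ : 0 < γ) (hγ1 : γ ≤ 1)
    (hε : 0 < ε) {i j : V} (hj : jac H i j ≤ ε) :
    cc H i j * ww G γ i j ≤ ε / γ := by
  have h1 := cc_small h hε hj
  calc cc H i j * ww G γ i j ≤ (ε * uu G i j) * (1 / uu G i j) :=
        mul_le_mul h1 (ww_le ..) (ww_nonneg ..) ((cc_nonneg ..).trans h1)
    _ = ε * (uu G i j / uu G i j) := by ring
    _ ≤ ε * 1 := by gcongr; exact div_self_le_one _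
    _ ≤ _ := by rw [mul_one, le_div_iff₀ hγ]; nlinarith

/-- Total weight lost when deleting `ij` (half of it). -/
lemma loss {G H : SimpleGraph V} (h : H ≤ G) {γ ε : ℝ} (hγ : 0 < γ) (hγ1 : γ ≤ 1)
    (hε : 0 < ε) {i j : V} (hij : H.Adj i j) (hj : jac H i j ≤ ε) :
    ∑ k ∈ H.neighborFinset i ∩ H.neighborFinset j, (ww G γ i j + ww G γ i k + ww G γ j k)
      ≤ bb G γ ε i j := by
  have key : ∀ k ∈ H.neighborFinset i ∩ H.neighborFinset j,
      cc H i j * (ww G γ i j + ww G γ i k + ww G γ j k) ≤ bb G γ ε i j := by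
    intro k hk
    simp only [Finset.mem_inter, SimpleGraph.mem_neighborFinset] at hk
    have hG := h hij
    have hik := h hk.1
    have hjk := h hk.2
    by_cases hg : γ ≤ jac G i j
    · have e1 := side_good h hγ hε hG hik hj hg
      have e2 := side_good h hγ hε hG.symm hjk (jac_comm H i j ▸ hj) (jac_comm G i j ▸ hg)
      rw [cc_comm] at e2
      have e3 := mid_good h hγ hγ1 hε hj
      have : bb G γ ε i j = 3 * (ε / γ) := by
        unfold bb; rw [if_pos ⟨hG, hg⟩]; ring
      rw [this]; linarith
    · have e1 := side_bad h γ hG hik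
      have e2 := side_bad h γ hG.symm hjk
      rw [cc_comm] at e2
      have e3 : ww G γ i j = 0 := by unfold ww; rw [if_neg (fun q => hg q.2)]
      have : bb G γ ε i j = 2 := by
        unfold bb; rw [if_neg (fun q => hg q.2)]
      rw [this, e3]; linarith
  have hb : 0 ≤ bb G γ ε i j := by unfold bb; split_ifs <;> positivity
  rcases Finset.eq_empty_or_nonempty (H.neighborFinset i ∩ H.neighborFinset j) with he | hne
  · rw [he]; simpa using hb
  · have hpos : 0 < cc H i j := by unfold cc; exact_mod_cast hne.card_pos
    have h5 : ∀ k ∈ H.neighborFinset i ∩ H.neighborFinset j,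
      (ww G γ i j + ww G γ i k + ww G γ j k) ≤ bb G γ ε i j / cc H i j := by
      intro k hk
      rw [le_div_iff₀ hpos, mul_comm]; exact key k hk
    refine (Finset.sum_le_card_nsmul _ _ _ h5).trans ?_
    rw [nsmul_eq_mul]
    change cc H i j * _ ≤ _
    rw [mul_div_cancel₀ _ hpos.ne']

lemma Phi_step (G H H' : SimpleGraph V) (γ : ℝ) {i j : V}
    (hH' : H' = H.deleteEdges {s(i, j)}) :
    Phi G γ H ≤ Phi G γ H' +
      2 * ∑ k ∈ H.neighborFinset i ∩ H.neighborFinset j,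
        (ww G γ i j + ww G γ i k + ww G γ j k) := by
  have hadj : ∀ x y, H'.Adj x y ↔ H.Adj x y ∧ s(x, y) ≠ s(i, j) := by
    intro x y; rw [hH']; simp [SimpleGraph.deleteEdges_adj]
  clear hH'
  set C := H.neighborFinset i ∩ H.neighborFinset j with hC
  have hmem : ∀ k, k ∈ C ↔ H.Adj i k ∧ H.Adj j k := by intro k; simp [hC]
  have pt : ∀ x y z, (if H.Adj x y ∧ H.Adj x z ∧ H.Adj y z then ww G γ x y else 0) ≤
      (if H'.Adj x y ∧ H'.Adj x z ∧
        H'.Adj y z then ww G γ x y else 0)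
      + ((if x = i then if y = j then if z ∈ C then ww G γ i j else 0 else 0 else 0)
      + (if x = j then if y = i then if z ∈ C then ww G γ i j else 0 else 0 else 0)
      + (if x = i then if z = j then if y ∈ C then ww G γ i y else 0 else 0 else 0)
      + (if x = j then if z = i then if y ∈ C then ww G γ j y else 0 else 0 else 0)
      + (if y = i then if z = j then if x ∈ C then ww G γ i x else 0 else 0 else 0)
      + (if y = j then if z = i then if x ∈ C then ww G γ j x else 0 else 0 else 0)) := by
    intro x y z
    have p1 : 0 ≤ (if H'.Adj x y ∧ H'.Adj x z ∧
        H'.Adj y z then ww G γ x y else 0) := by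
      split_ifs <;> simp [ww_nonneg]
    have p2 : 0 ≤ (if x = i then if y = j then if z ∈ C then ww G γ i j else 0 else 0 else 0) := by
      split_ifs <;> simp [ww_nonneg]
    have p3 : 0 ≤ (if x = j then if y = i then if z ∈ C then ww G γ i j else 0 else 0 else 0) := by
      split_ifs <;> simp [ww_nonneg]
    have p4 : 0 ≤ (if x = i then if z = j then if y ∈ C then ww G γ i y else 0 else 0 else 0) := by
      split_ifs <;> simp [ww_nonneg]
    have p5 : 0 ≤ (if x = j then if z = i then if y ∈ C then ww G γ j y else 0 else 0 else 0) := by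
      split_ifs <;> simp [ww_nonneg]
    have p6 : 0 ≤ (if y = i then if z = j then if x ∈ C then ww G γ i x else 0 else 0 else 0) := by
      split_ifs <;> simp [ww_nonneg]
    have p7 : 0 ≤ (if y = j then if z = i then if x ∈ C then ww G γ j x else 0 else 0 else 0) := by
      split_ifs <;> simp [ww_nonneg]
    by_cases ht : H.Adj x y ∧ H.Adj x z ∧ H.Adj y z
    · rw [if_pos ht]
      obtain ⟨a, b, c⟩ := ht
      by_cases q1 : s(x, y) = s(i, j)
      · rcases Sym2.eq_iff.mp q1 with ⟨rfl, rfl⟩ | ⟨rfl, rfl⟩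
        · have : (if x = x then if y = y then if z ∈ C then ww G γ x y else 0 else 0 else 0)
            = ww G γ x y := by
            rw [if_pos rfl, if_pos rfl, if_pos ((hmem z).2 ⟨b, c⟩)]
          linarith
        · have hs : ww G γ y x = ww G γ x y := ww_comm ..
          have : (if x = x then if y = y then if z ∈ C then ww G γ y x else 0 else 0 else 0)
            = ww G γ y x := by
            rw [if_pos rfl, if_pos rfl, if_pos ((hmem z).2 ⟨c, b⟩)]
          linarith
      by_cases q2 : s(x, z) = s(i, j)
      · rcases Sym2.eq_iff.mp q2 with ⟨rfl, rfl⟩ | ⟨rfl, rfl⟩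
        · have : (if x = x then if z = z then if y ∈ C then ww G γ x y else 0 else 0 else 0)
            = ww G γ x y := by
            rw [if_pos rfl, if_pos rfl, if_pos ((hmem y).2 ⟨a, c.symm⟩)]
          linarith
        · have : (if x = x then if z = z then if y ∈ C then ww G γ x y else 0 else 0 else 0)
            = ww G γ x y := by
            rw [if_pos rfl, if_pos rfl, if_pos ((hmem y).2 ⟨c.symm, a⟩)]
          linarith
      by_cases q3 : s(y, z) = s(i, j)
      · have hs : ww G γ y x = ww G γ x y := ww_comm ..
        rcases Sym2.eq_iff.mp q3 with ⟨rfl, rfl⟩ | ⟨rfl, rfl⟩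
        · have : (if y = y then if z = z then if x ∈ C then ww G γ y x else 0 else 0 else 0)
            = ww G γ y x := by
            rw [if_pos rfl, if_pos rfl, if_pos ((hmem x).2 ⟨a.symm, b.symm⟩)]
          linarith
        · have : (if y = y then if z = z then if x ∈ C then ww G γ y x else 0 else 0 else 0)
            = ww G γ y x := by
            rw [if_pos rfl, if_pos rfl, if_pos ((hmem x).2 ⟨b.symm, a.symm⟩)]
          linarith
      have hd : H'.Adj x y ∧ H'.Adj x z ∧
        H'.Adj y z := by
        simp only [hadj]
        exact ⟨⟨a, q1⟩, ⟨b, q2⟩, ⟨c, q3⟩⟩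
      rw [if_pos hd]
      linarith
    · rw [if_neg ht]
      linarith
  unfold Phi
  refine (Finset.sum_le_sum fun x _ => Finset.sum_le_sum fun y _ =>
    Finset.sum_le_sum fun z _ => pt x y z).trans ?_
  simp only [Finset.sum_add_distrib]
  have s1 : ∀ (a b : V) (f : V → ℝ),
      (∑ x, ∑ y, ∑ z, if x = a then if y = b then if z ∈ C then f z else 0 else 0 else 0)
      = ∑ z ∈ C, f z := by
    intro a b f
    rw [Finset.sum_eq_single a (by intro x _ hx; simp [hx]) (by simp),
      Finset.sum_eq_single b (by intro x _ hx; simp [hx]) (by simp)]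
    simp [Finset.sum_ite_mem]
  have s2 : ∀ (a b : V) (f : V → ℝ),
      (∑ x, ∑ y, ∑ z, if x = a then if z = b then if y ∈ C then f y else 0 else 0 else 0)
      = ∑ z ∈ C, f z := by
    intro a b f
    rw [← s1 a b f]
    exact Finset.sum_congr rfl fun x _ => Finset.sum_comm
  have s3 : ∀ (a b : V) (f : V → ℝ),
      (∑ x, ∑ y, ∑ z, if y = a then if z = b then if x ∈ C then f x else 0 else 0 else 0)
      = ∑ z ∈ C, f z := by
    intro a b f
    rw [← s2 a b f]
    exact Finset.sum_comm
  rw [s1 i j (fun _ => ww G γ i j), s1 j i (fun _ => ww G γ i j), s2 i j, s2 j i, s3 i j, s3 j i]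
  linarith

lemma Chg_step (G H H' : SimpleGraph V) (γ ε : ℝ) {i j : V} (hij : H.Adj i j)
    (hH' : H' = H.deleteEdges {s(i, j)}) :
    Chg G γ ε H = Chg G γ ε H' + 2 * bb G γ ε i j := by
  have hadj : ∀ x y, H'.Adj x y ↔ H.Adj x y ∧ s(x, y) ≠ s(i, j) := by
    intro x y; rw [hH']; simp [SimpleGraph.deleteEdges_adj]
  clear hH'
  have pt : ∀ x y, (if H.Adj x y then bb G γ ε x y else 0) =
      (if H'.Adj x y then bb G γ ε x y else 0) +
      ((if x = i then if y = j then bb G γ ε i j else 0 else 0) +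
       (if x = j then if y = i then bb G γ ε i j else 0 else 0)) := by
    intro x y
    have hne := hij.ne
    have hc := bb_comm G γ ε i j
    simp only [hadj, ne_eq, Sym2.eq_iff]
    by_cases h1 : x = i ∧ y = j
    · obtain ⟨rfl, rfl⟩ := h1
      simp [hij, hne]
    by_cases h2 : x = j ∧ y = i
    · obtain ⟨rfl, rfl⟩ := h2
      simp [hij.symm, hne, hc]
    · have e1 : (if x = i then if y = j then bb G γ ε i j else 0 else 0) = 0 := by
        split_ifs <;> tauto
      have e2 : (if x = j then if y = i then bb G γ ε i j else 0 else 0) = 0 := by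
        split_ifs <;> tauto
      rw [e1, e2]
      simp [h1, h2]
  unfold Chg
  rw [Finset.sum_congr rfl fun x _ => Finset.sum_congr rfl fun y _ => pt x y]
  simp only [Finset.sum_add_distrib]
  have s1 : ∀ (a b : V) (c : ℝ), (∑ x, ∑ y, if x = a then if y = b then c else 0 else 0) = c := by
    intro a b c
    rw [Finset.sum_eq_single a (by intro x _ hx; simp [hx]) (by simp)]
    simp
  rw [s1, s1]; ring

lemma count_pairs (H : SimpleGraph V) (P : Sym2 V → Prop) [Fintype H.edgeSet]
    [DecidablePred P] :
    (∑ x, ∑ y, if H.Adj x y ∧ P s(x, y) then (1 : ℝ) else 0) =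
      2 * ((H.edgeFinset.filter P).card : ℝ) := by
  let K : SimpleGraph V :=
    { Adj := fun x y => H.Adj x y ∧ P s(x, y)
      symm := ⟨fun x y h => ⟨h.1.symm, Sym2.eq_swap (a := x) ▸ h.2⟩⟩
      loopless := ⟨fun x h => H.loopless.irrefl x h.1⟩ }
  have hK : K.edgeFinset = H.edgeFinset.filter P := by
    ext e
    induction e using Sym2.ind with
    | _ x y => simp [K]
  have := K.sum_degrees_eq_twice_card_edges
  rw [hK] at this
  rw [show (2 : ℝ) * ((H.edgeFinset.filter P).card : ℝ) =
    ((2 * (H.edgeFinset.filter P).card : ℕ) : ℝ) by push_cast; ring, ← this]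
  push_cast
  refine Finset.sum_congr rfl fun x _ => ?_
  rw [Finset.sum_boole]
  congr 1
  rw [← SimpleGraph.card_neighborFinset_eq_degree]
  congr 1
  ext y
  simp [K]

lemma Phi_inner (G H : SimpleGraph V) (γ : ℝ) (x y : V) :
    (∑ z, if H.Adj x y ∧ H.Adj x z ∧ H.Adj y z then ww G γ x y else 0) =
      if H.Adj x y then cc H x y * ww G γ x y else 0 := by
  by_cases h : H.Adj x y
  · simp only [h, true_and, if_true]
    rw [← Finset.sum_filter, Finset.sum_const, nsmul_eq_mul]
    unfold cc
    congr 3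
    ext z; simp
  · simp [h]

end helpers

/-- Surviving edges after cleaning: after iteratively deleting edges of Jaccard similarity
at most `ε` from a graph in which at least a `μ ≥ 1 − γ²/32` fraction of the edges have
Jaccard similarity at least `γ` (with `0 < ε ≤ γ³/12`), at least `γ·|E(G)|/4` edges of the
final graph lie in a triangle of the final graph. -/
theorem surviving_edges {V : Type*} [Fintype V] [DecidableEq V]
    (G : SimpleGraph V) (γ μ ε : ℝ) (hγ0 : 0 < γ) (hγ1 : γ ≤ 1)
    (hμ : 1 - γ ^ 2 / 32 ≤ μ) (hε0 : 0 < ε) (hε1 : ε ≤ γ ^ 3 / 12)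
    (hgood : μ * (ecount G : ℝ) ≤
      ((G.edgeFinset.filter (fun e => ∀ i j, e = s(i, j) → γ ≤ jac G i j)).card : ℝ))
    (m : ℕ) (Gs : ℕ → SimpleGraph V) (h0 : Gs 0 = G)
    (hstep : ∀ l < m, ∃ i j, (Gs l).Adj i j ∧ jac (Gs l) i j ≤ ε ∧
      Gs (l + 1) = (Gs l).deleteEdges {s(i, j)}) :
    γ * (ecount G : ℝ) / 4 ≤
      (((Gs m).edgeFinset.filter
        (fun e => ∃ t ∈ (Gs m).cliqueFinset 3, ∀ v ∈ e, v ∈ t)).card : ℝ) := by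
  set P : Sym2 V → Prop := fun e => ∀ i j, e = s(i, j) → γ ≤ jac G i j with hP
  have hPs : ∀ x y, P s(x, y) ↔ γ ≤ jac G x y := by
    intro x y
    constructor
    · intro h; exact h x y rfl
    · intro h i j hij
      rcases Sym2.eq_iff.mp hij with ⟨rfl, rfl⟩ | ⟨rfl, rfl⟩
      · exact h
      · rwa [jac_comm]
  -- induction along the sequence
  have hind : ∀ l ≤ m, Gs l ≤ G ∧
      Phi G γ G - Chg G γ ε G ≤ Phi G γ (Gs l) - Chg G γ ε (Gs l) := by
    intro l
    induction l with
    | zero => intro _; rw [h0]; exact ⟨le_rfl, le_rfl⟩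
    | succ l ih =>
      intro hl
      obtain ⟨hle, hin⟩ := ih (by omega)
      obtain ⟨i, j, hij, hj, he⟩ := hstep l (by omega)
      refine ⟨he ▸ (SimpleGraph.deleteEdges_le _).trans hle, ?_⟩
      have a1 := Phi_step G (Gs l) _ γ he
      have a2 := Chg_step G (Gs l) _ γ ε hij he
      have a3 := loss hle hγ0 hγ1 hε0 hij hj
      linarith
  obtain ⟨hle, hfin⟩ := hind m le_rfl
  have hE : (∑ x, ∑ y, if G.Adj x y then (1 : ℝ) else 0) = 2 * (ecount G : ℝ) := by
    have := count_pairs G (fun _ => True)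
    simpa [ecount] using this
  obtain ⟨g, hgdef⟩ : ∃ g : ℝ, g = ((G.edgeFinset.filter P).card : ℝ) := ⟨_, rfl⟩
  have hg : (∑ x, ∑ y, if G.Adj x y ∧ P s(x, y) then (1 : ℝ) else 0) = 2 * g := by
    rw [hgdef]; convert count_pairs G P
  have hC0 : 0 ≤ Chg G γ ε (Gs m) := by
    unfold Chg
    refine Finset.sum_nonneg fun x _ => Finset.sum_nonneg fun y _ => ?_
    unfold bb
    split_ifs <;> positivity
  have hCG : Chg G γ ε G = (3 * ε / γ - 2) * (2 * g) + 2 * (2 * (ecount G : ℝ)) := by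
    rw [← hE, ← hg, Finset.mul_sum, Finset.mul_sum, ← Finset.sum_add_distrib]
    unfold Chg
    refine Finset.sum_congr rfl fun x _ => ?_
    rw [Finset.mul_sum, Finset.mul_sum, ← Finset.sum_add_distrib]
    refine Finset.sum_congr rfl fun y _ => ?_
    unfold bb
    simp only [hPs]
    by_cases q : G.Adj x y <;> by_cases q' : γ ≤ jac G x y <;> simp [q, q']
  have hPG : γ * (2 * g) ≤ Phi G γ G := by
    rw [← hg, Finset.mul_sum]
    unfold Phi
    refine Finset.sum_le_sum fun x _ => ?_
    rw [Finset.mul_sum]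
    refine Finset.sum_le_sum fun y _ => ?_
    rw [Phi_inner]
    simp only [hPs]
    unfold ww
    by_cases q : G.Adj x y <;> by_cases q' : γ ≤ jac G x y <;> simp [q, q']
    rw [jac_eq] at q'
    simpa [div_eq_mul_inv] using q'
  have hPm : Phi G γ (Gs m) ≤ 2 * (((Gs m).edgeFinset.filter
        (fun e => ∃ t ∈ (Gs m).cliqueFinset 3, ∀ v ∈ e, v ∈ t)).card : ℝ) := by
    rw [← count_pairs]
    unfold Phi
    refine Finset.sum_le_sum fun x _ => Finset.sum_le_sum fun y _ => ?_
    rw [Phi_inner]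
    by_cases q : (Gs m).Adj x y
    · rw [if_pos q]
      by_cases hk : ∃ k, (Gs m).Adj x k ∧ (Gs m).Adj y k
      · obtain ⟨k, k1, k2⟩ := hk
        rw [if_pos]
        · exact side_bad hle γ (hle q) (hle q)
        · refine ⟨q, {x, y, k}, ?_, ?_⟩
          · rw [SimpleGraph.mem_cliqueFinset_iff]
            exact SimpleGraph.is3Clique_triple_iff.2 ⟨q, k1, k2⟩
          · intro v hv
            rcases Sym2.mem_iff.mp hv with rfl | rfl <;> simp
      · have : cc (Gs m) x y = 0 := by
          unfold cc
          rw [Nat.cast_eq_zero, Finset.card_eq_zero, Finset.eq_empty_iff_forall_notMem]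
          intro k hk'
          apply hk
          simp only [Finset.mem_inter, SimpleGraph.mem_neighborFinset] at hk'
          exact ⟨k, hk'⟩
        rw [this, zero_mul]
        split_ifs <;> norm_num
    · rw [if_neg q]
      split_ifs <;> norm_num
  have hE0 : (0 : ℝ) ≤ (ecount G : ℝ) := by positivity
  have hgE : g ≤ (ecount G : ℝ) := by
    rw [hgdef]; unfold ecount
    exact_mod_cast Finset.card_le_card (Finset.filter_subset _ _)
  have hg0 : (0 : ℝ) ≤ g := by rw [hgdef]; positivity
  have hglow : (1 - γ ^ 2 / 32) * (ecount G : ℝ) ≤ g :=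
    (mul_le_mul_of_nonneg_right hμ hE0).trans (by rw [hgdef]; convert hgood)
  have he3 : 3 * ε / γ ≤ γ / 4 := by
    rw [div_le_iff₀ hγ0]
    nlinarith [sq_nonneg γ]
  have hmain : 2 * (γ * g) - 2 * ((γ / 4) * g) - 4 * ((ecount G : ℝ) - g) ≤ 2 * (((Gs m).edgeFinset.filter
        (fun e => ∃ t ∈ (Gs m).cliqueFinset 3, ∀ v ∈ e, v ∈ t)).card : ℝ) := by
    have := mul_le_mul_of_nonneg_right he3 hg0
    nlinarith
  have k1 : γ ^ 2 * (ecount G : ℝ) ≤ γ * (ecount G : ℝ) := by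
    apply mul_le_mul_of_nonneg_right _ hE0; nlinarith
  have k2 : γ * ((1 - γ ^ 2 / 32) * (ecount G : ℝ)) ≤ γ * g :=
    mul_le_mul_of_nonneg_left hglow hγ0.le
  have k3 : γ * (γ ^ 2 * (ecount G : ℝ)) ≤ γ * (ecount G : ℝ) := by
    have : γ * (γ ^ 2 * (ecount G : ℝ)) ≤ 1 * (γ ^ 2 * (ecount G : ℝ)) :=
      mul_le_mul_of_nonneg_right hγ1 (by positivity)
    linarith
  have k4 : 0 ≤ γ * (ecount G : ℝ) := by positivity
  linarith
end
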